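/- arXiv:1912.08879 — 2 statements merged into one kernel-verified Lean document; each statement's English description precedes it below -/
import Mathlib

section
/- Let ψ be a smooth function of t = |z|² and P ∈ ℕⁿ a multi-index with |P| = p. Then there is a constant C (depending only on p, l, and ψ, not on the particular P with |P| = p) such that (Δ_c)^l ( |z^P|² ψ(|z|²) ) evaluated at z = 0 equals C · p! · P! for every multi-index P with |P| = p. -/
/-- The Wirtinger derivative `∂/∂z_i` of a function on `ℂⁿ`. -/
noncomputable def dz {n : ℕ} (i : Fin n) (f : (Fin n → ℂ) → ℂ) : (Fin n → ℂ) → ℂ :=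
  fun z => (fderiv ℝ f z (Pi.single i 1) - Complex.I * fderiv ℝ f z (Pi.single i Complex.I)) / 2

/-- The Wirtinger derivative `∂/∂\bar z_i` of a function on `ℂⁿ`. -/
noncomputable def dzbar {n : ℕ} (i : Fin n) (f : (Fin n → ℂ) → ℂ) : (Fin n → ℂ) → ℂ :=
  fun z => (fderiv ℝ f z (Pi.single i 1) + Complex.I * fderiv ℝ f z (Pi.single i Complex.I)) / 2

/-- The complex Euclidean Laplacian `Δ_c = ∑ i, ∂²/(∂z_i ∂\bar z_i)`. -/
noncomputable def lapC {n : ℕ} (f : (Fin n → ℂ) → ℂ) : (Fin n → ℂ) → ℂ :=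
  fun z => ∑ i, dzbar i (dz i f) z

open scoped ContDiff

/-- auxiliary function `z_i^a * conj z_i^b * M_i(z) * φ(|z|²)`. -/
noncomputable def auxE {n : ℕ} (i : Fin n) (P : Fin n → ℕ) (a b : ℕ) (φ : ℝ → ℝ) :
    (Fin n → ℂ) → ℂ :=
  fun z => z i ^ a * (starRingEnd ℂ (z i)) ^ b *
    (∏ j ∈ Finset.univ.erase i, (z j * starRingEnd ℂ (z j)) ^ P j) *
    ((φ (∑ j, Complex.normSq (z j)) : ℝ) : ℂ)

/-- the main function. -/
noncomputable def auxF {n : ℕ} (P : Fin n → ℕ) (φ : ℝ → ℝ) : (Fin n → ℂ) → ℂ :=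
  fun z => (∏ i, (z i * starRingEnd ℂ (z i)) ^ P i) *
          ((φ (∑ i, Complex.normSq (z i)) : ℝ) : ℂ)

lemma contDiff_conj_coord {n : ℕ} (i : Fin n) :
    ContDiff ℝ ∞ (fun z : Fin n → ℂ => starRingEnd ℂ (z i)) :=
  Complex.conjCLE.contDiff.comp (contDiff_apply ℝ ℂ i)

lemma contDiff_coord {n : ℕ} (i : Fin n) :
    ContDiff ℝ ∞ (fun z : Fin n → ℂ => z i) :=
  contDiff_apply ℝ ℂ i

lemma contDiff_radial {n : ℕ} {φ : ℝ → ℝ} (hφ : ContDiff ℝ ∞ φ) :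
    ContDiff ℝ ∞ (fun z : Fin n → ℂ => ((φ (∑ j, Complex.normSq (z j)) : ℝ) : ℂ)) := by
  refine Complex.ofRealCLM.contDiff.comp (hφ.comp ?_)
  refine ContDiff.sum fun j _ => ?_
  simp only [Complex.normSq_apply]
  have h1 : ContDiff ℝ ∞ (fun z : Fin n → ℂ => (z j).re) :=
    Complex.reCLM.contDiff.comp (contDiff_coord j)
  have h2 : ContDiff ℝ ∞ (fun z : Fin n → ℂ => (z j).im) :=
    Complex.imCLM.contDiff.comp (contDiff_coord j)
  exact (h1.mul h1).add (h2.mul h2)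

lemma contDiff_auxE {n : ℕ} (i : Fin n) (P : Fin n → ℕ) (a b : ℕ) {φ : ℝ → ℝ}
    (hφ : ContDiff ℝ ∞ φ) : ContDiff ℝ ∞ (auxE i P a b φ) := by
  refine ContDiff.mul (ContDiff.mul (ContDiff.mul ((contDiff_coord i).pow a)
    ((contDiff_conj_coord i).pow b)) ?_) (contDiff_radial hφ)
  exact contDiff_prod fun j _ => ((contDiff_coord j).mul (contDiff_conj_coord j)).pow _

lemma contDiff_auxF {n : ℕ} (P : Fin n → ℕ) {φ : ℝ → ℝ}
    (hφ : ContDiff ℝ ∞ φ) : ContDiff ℝ ∞ (auxF P φ) := by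
  refine ContDiff.mul ?_ (contDiff_radial hφ)
  exact contDiff_prod fun j _ => ((contDiff_coord j).mul (contDiff_conj_coord j)).pow _

lemma auxF_eq {n : ℕ} (i : Fin n) (P : Fin n → ℕ) (φ : ℝ → ℝ) :
    auxF P φ = auxE i P (P i) (P i) φ := by
  funext z
  simp only [auxF, auxE]
  rw [← Finset.mul_prod_erase _ _ (Finset.mem_univ i), mul_pow]

lemma fderiv_auxE {n : ℕ} (i : Fin n) (P : Fin n → ℕ) (a b : ℕ) {φ : ℝ → ℝ}
    (hφ : ContDiff ℝ ∞ φ) (z : Fin n → ℂ) (w : ℂ) :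
    fderiv ℝ (auxE i P a b φ) z (Pi.single i w) =
      w * (a * auxE i P (a - 1) b φ z + auxE i P a (b + 1) (deriv φ) z) +
      starRingEnd ℂ w * (b * auxE i P a (b - 1) φ z + auxE i P (a + 1) b (deriv φ) z) := by
  have hd : DifferentiableAt ℝ (auxE i P a b φ) z :=
    ((contDiff_auxE i P a b hφ).differentiable (by simp)) z
  have hline : HasDerivAt (fun t : ℝ => z + t • (Pi.single i w : Fin n → ℂ))
      (Pi.single i w) 0 := by
    simpa using ((hasDerivAt_id (0 : ℝ)).smul_const (Pi.single i w : Fin n → ℂ)).const_add z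
  have h1 : HasDerivAt (fun t : ℝ => auxE i P a b φ (z + t • (Pi.single i w : Fin n → ℂ)))
      (fderiv ℝ (auxE i P a b φ) z (Pi.single i w)) 0 := by
    have hd' : HasFDerivAt (auxE i P a b φ) (fderiv ℝ (auxE i P a b φ) z)
      (z + (0 : ℝ) • (Pi.single i w : Fin n → ℂ)) := by simpa using hd.hasFDerivAt
    exact hd'.comp_hasDerivAt (0 : ℝ) hline
  have hc : HasDerivAt (fun t : ℝ => z i + t * w) w 0 := by
    simpa using ((Complex.ofRealCLM.hasDerivAt (x := (0 : ℝ))).mul_const w).const_add (z i)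
  have hcc : HasDerivAt (fun t : ℝ => starRingEnd ℂ (z i) + t * starRingEnd ℂ w)
      (starRingEnd ℂ w) 0 := by
    simpa using ((Complex.ofRealCLM.hasDerivAt (x := (0 : ℝ))).mul_const
      (starRingEnd ℂ w)).const_add (starRingEnd ℂ (z i))
  have hns : HasDerivAt (fun t : ℝ => (∑ j, Complex.normSq (z j)) +
      (2 * (z i * starRingEnd ℂ w).re * t + Complex.normSq w * t ^ 2))
      (2 * (z i * starRingEnd ℂ w).re) 0 := by
    have := (((hasDerivAt_id (0 : ℝ)).const_mul (2 * (z i * starRingEnd ℂ w).re)).add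
      (((hasDerivAt_id (0 : ℝ)).pow 2).const_mul (Complex.normSq w))).const_add
      (∑ j, Complex.normSq (z j))
    simpa using this
  have hφ0 : HasDerivAt φ (deriv φ (∑ j, Complex.normSq (z j))) ((∑ j, Complex.normSq (z j)) +
      (2 * (z i * starRingEnd ℂ w).re * (0 : ℝ) + Complex.normSq w * (0 : ℝ) ^ 2)) := by
    simpa using ((hφ.differentiable (by simp)) (∑ j, Complex.normSq (z j))).hasDerivAt
  have hr := (hφ0.comp (0 : ℝ) hns).ofReal_comp
  have h2 := ((((hc.pow a).mul (hcc.pow b)).mul_const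
    (∏ j ∈ Finset.univ.erase i, (z j * starRingEnd ℂ (z j)) ^ P j)).mul hr)
  have heq : (fun t : ℝ => auxE i P a b φ (z + t • (Pi.single i w : Fin n → ℂ))) =
      fun t : ℝ => (z i + t * w) ^ a * (starRingEnd ℂ (z i) + t * starRingEnd ℂ w) ^ b *
      (∏ j ∈ Finset.univ.erase i, (z j * starRingEnd ℂ (z j)) ^ P j) *
      ((φ ((∑ j, Complex.normSq (z j)) +
      (2 * (z i * starRingEnd ℂ w).re * t + Complex.normSq w * t ^ 2)) : ℝ) : ℂ) := by
    funext t
    have e1 : (∏ j ∈ Finset.univ.erase i, ((z + t • (Pi.single i w : Fin n → ℂ)) j *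
        starRingEnd ℂ ((z + t • (Pi.single i w : Fin n → ℂ)) j)) ^ P j) =
        ∏ j ∈ Finset.univ.erase i, (z j * starRingEnd ℂ (z j)) ^ P j := by
      refine Finset.prod_congr rfl fun j hj => ?_
      have : j ≠ i := Finset.ne_of_mem_erase hj
      simp [Pi.single_eq_of_ne this]
    have e2 : (∑ j, Complex.normSq ((z + t • (Pi.single i w : Fin n → ℂ)) j)) =
        (∑ j, Complex.normSq (z j)) +
      (2 * (z i * starRingEnd ℂ w).re * t + Complex.normSq w * t ^ 2) := by
      rw [← Finset.add_sum_erase _ _ (Finset.mem_univ i),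
        ← Finset.add_sum_erase _ (fun j => Complex.normSq (z j)) (Finset.mem_univ i)]
      have e3 : ∑ j ∈ Finset.univ.erase i,
          Complex.normSq ((z + t • (Pi.single i w : Fin n → ℂ)) j) =
          ∑ j ∈ Finset.univ.erase i, Complex.normSq (z j) := by
        refine Finset.sum_congr rfl fun j hj => ?_
        have : j ≠ i := Finset.ne_of_mem_erase hj
        simp [Pi.single_eq_of_ne this]
      rw [e3]
      simp [Complex.normSq_apply]
      ring
    simp only [auxE]
    rw [e1, e2]
    simp
  rw [heq] at h1
  have h3 := h1.unique h2
  rw [h3]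
  have hre : ((2 * (z i * starRingEnd ℂ w).re : ℝ) : ℂ) =
      z i * starRingEnd ℂ w + starRingEnd ℂ (z i) * w := by
    apply Complex.ext <;> simp <;> ring
  simp only [auxE, Complex.ofReal_mul (deriv φ _), hre]
  simp
  ring

lemma dz_auxE {n : ℕ} (i : Fin n) (P : Fin n → ℕ) (a b : ℕ) {φ : ℝ → ℝ}
    (hφ : ContDiff ℝ ∞ φ) :
    dz i (auxE i P a b φ) =
      fun z => a * auxE i P (a - 1) b φ z + auxE i P a (b + 1) (deriv φ) z := by
  funext z
  simp only [dz, fderiv_auxE i P a b hφ]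
  simp only [map_one, Complex.conj_I]
  linear_combination (-(1 / 2) * (a * auxE i P (a - 1) b φ z + auxE i P a (b + 1) (deriv φ) z) +
    (1 / 2) * (b * auxE i P a (b - 1) φ z + auxE i P (a + 1) b (deriv φ) z)) * Complex.I_mul_I

lemma dzbar_auxE {n : ℕ} (i : Fin n) (P : Fin n → ℕ) (a b : ℕ) {φ : ℝ → ℝ}
    (hφ : ContDiff ℝ ∞ φ) :
    dzbar i (auxE i P a b φ) =
      fun z => b * auxE i P a (b - 1) φ z + auxE i P (a + 1) b (deriv φ) z := by
  funext z
  simp only [dzbar, fderiv_auxE i P a b hφ]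
  simp only [map_one, Complex.conj_I]
  linear_combination ((1 / 2) * (a * auxE i P (a - 1) b φ z + auxE i P a (b + 1) (deriv φ) z) -
    (1 / 2) * (b * auxE i P a (b - 1) φ z + auxE i P (a + 1) b (deriv φ) z)) * Complex.I_mul_I

lemma contDiff_fderiv_apply {n : ℕ} {f : (Fin n → ℂ) → ℂ} (hf : ContDiff ℝ ∞ f)
    (v : Fin n → ℂ) : ContDiff ℝ ∞ (fun z => fderiv ℝ f z v) :=
  (hf.fderiv_right (m := ∞) (by simp)).clm_apply contDiff_const

lemma contDiff_dz {n : ℕ} (i : Fin n) {f : (Fin n → ℂ) → ℂ} (hf : ContDiff ℝ ∞ f) :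
    ContDiff ℝ ∞ (dz i f) :=
  ((contDiff_fderiv_apply hf _).sub
    (contDiff_const.mul (contDiff_fderiv_apply hf _))).div_const 2

lemma contDiff_dzbar {n : ℕ} (i : Fin n) {f : (Fin n → ℂ) → ℂ} (hf : ContDiff ℝ ∞ f) :
    ContDiff ℝ ∞ (dzbar i f) :=
  ((contDiff_fderiv_apply hf _).add
    (contDiff_const.mul (contDiff_fderiv_apply hf _))).div_const 2

lemma contDiff_lapC {n : ℕ} {f : (Fin n → ℂ) → ℂ} (hf : ContDiff ℝ ∞ f) :
    ContDiff ℝ ∞ (lapC f) :=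
  ContDiff.sum fun i _ => contDiff_dzbar i (contDiff_dz i hf)

lemma fderiv_lin {n : ℕ} {f g : (Fin n → ℂ) → ℂ} (hf : ContDiff ℝ ∞ f)
    (hg : ContDiff ℝ ∞ g) (c : ℂ) (z v : Fin n → ℂ) :
    fderiv ℝ (fun z => c * f z + g z) z v = c * fderiv ℝ f z v + fderiv ℝ g z v := by
  have h1 : DifferentiableAt ℝ f z := hf.differentiable (by simp) z
  have h2 : DifferentiableAt ℝ g z := hg.differentiable (by simp) z
  have := ((h1.hasFDerivAt.const_mul c).add h2.hasFDerivAt).fderiv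
  have e : (fun z => c * f z + g z) = (fun z => c * f z) + g := rfl
  rw [e, this]
  simp

lemma dz_lin {n : ℕ} (i : Fin n) {f g : (Fin n → ℂ) → ℂ} (hf : ContDiff ℝ ∞ f)
    (hg : ContDiff ℝ ∞ g) (c : ℂ) :
    dz i (fun z => c * f z + g z) = fun z => c * dz i f z + dz i g z := by
  funext z
  simp only [dz, fderiv_lin hf hg]
  ring

lemma dzbar_lin {n : ℕ} (i : Fin n) {f g : (Fin n → ℂ) → ℂ} (hf : ContDiff ℝ ∞ f)
    (hg : ContDiff ℝ ∞ g) (c : ℂ) :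
    dzbar i (fun z => c * f z + g z) = fun z => c * dzbar i f z + dzbar i g z := by
  funext z
  simp only [dzbar, fderiv_lin hf hg]
  ring

lemma lapC_lin {n : ℕ} {f g : (Fin n → ℂ) → ℂ} (hf : ContDiff ℝ ∞ f)
    (hg : ContDiff ℝ ∞ g) (c : ℂ) :
    lapC (fun z => c * f z + g z) = fun z => c * lapC f z + lapC g z := by
  funext z
  simp only [lapC, Finset.mul_sum, ← Finset.sum_add_distrib]
  refine Finset.sum_congr rfl fun i _ => ?_
  rw [dz_lin i hf hg, dzbar_lin i (contDiff_dz i hf) (contDiff_dz i hg)]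

lemma lapC_iter_lin {n : ℕ} (l : ℕ) : ∀ {f g : (Fin n → ℂ) → ℂ}, ContDiff ℝ ∞ f →
    ContDiff ℝ ∞ g → ∀ c : ℂ,
    lapC^[l] (fun z => c * f z + g z) = fun z => c * lapC^[l] f z + lapC^[l] g z := by
  induction l with
  | zero => intros; rfl
  | succ l ih =>
    intro f g hf hg c
    simp only [Function.iterate_succ_apply]
    rw [lapC_lin hf hg, ih (contDiff_lapC hf) (contDiff_lapC hg)]

lemma lapC_iter_sum {n : ℕ} {ι : Type*} (l : ℕ) (s : Finset ι) (c : ι → ℂ)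
    (f : ι → (Fin n → ℂ) → ℂ) (hf : ∀ i, ContDiff ℝ ∞ (f i)) {g : (Fin n → ℂ) → ℂ}
    (hg : ContDiff ℝ ∞ g) :
    lapC^[l] (fun z => ∑ i ∈ s, c i * f i z + g z) =
      fun z => ∑ i ∈ s, c i * lapC^[l] (f i) z + lapC^[l] g z := by
  classical
  induction s using Finset.induction_on with
  | empty => simp
  | insert a s ha ih =>
    simp only [Finset.sum_insert ha, add_assoc]
    rw [lapC_iter_lin l (hf a) ((ContDiff.sum fun i _ => contDiff_const.mul (hf i)).add hg), ih]

/-- radial operator -/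
noncomputable def auxD (n p : ℕ) (φ : ℝ → ℝ) : ℝ → ℝ :=
  fun s => (2 * p + n) * deriv φ s + s * deriv (deriv φ) s

lemma contDiff_deriv' {φ : ℝ → ℝ} (hφ : ContDiff ℝ ∞ φ) : ContDiff ℝ ∞ (deriv φ) :=
  (contDiff_infty_iff_deriv.1 hφ).2

lemma contDiff_auxD (n p : ℕ) {φ : ℝ → ℝ} (hφ : ContDiff ℝ ∞ φ) :
    ContDiff ℝ ∞ (auxD n p φ) :=
  (contDiff_const.mul (contDiff_deriv' hφ)).add
    (contDiff_id.mul (contDiff_deriv' (contDiff_deriv' hφ)))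

lemma dzbar_dz_auxF {n : ℕ} (i : Fin n) (P : Fin n → ℕ) {φ : ℝ → ℝ}
    (hφ : ContDiff ℝ ∞ φ) (z : Fin n → ℂ) :
    dzbar i (dz i (auxF P φ)) z =
      (P i : ℂ) ^ 2 * auxF (Function.update P i (P i - 1)) φ z +
      ((2 * P i + 1) * auxF P (deriv φ) z +
        Complex.normSq (z i) * auxF P (deriv (deriv φ)) z) := by
  have hφ' := contDiff_deriv' hφ
  rw [auxF_eq i P φ, dz_auxE i P _ _ hφ,
    dzbar_lin i (contDiff_auxE i P _ _ hφ) (contDiff_auxE i P _ _ hφ'),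
    dzbar_auxE i P _ _ hφ, dzbar_auxE i P _ _ hφ', auxF_eq i P, auxF_eq i P, auxF_eq i]
  have e1 : auxE i (Function.update P i (P i - 1)) (Function.update P i (P i - 1) i)
      (Function.update P i (P i - 1) i) φ z = auxE i P (P i - 1) (P i - 1) φ z := by
    simp only [auxE, Function.update_self]
    congr 2
    refine Finset.prod_congr rfl fun j hj => ?_
    rw [Function.update_of_ne (Finset.ne_of_mem_erase hj)]
  have e2 : (P i : ℂ) * auxE i P (P i - 1 + 1) (P i) (deriv φ) z =
      P i * auxE i P (P i) (P i) (deriv φ) z := by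
    rcases Nat.eq_zero_or_pos (P i) with h | h
    · simp [h]
    · rw [Nat.sub_add_cancel h]
  have e3 : auxE i P (P i + 1) (P i + 1) (deriv (deriv φ)) z =
      Complex.normSq (z i) * auxE i P (P i) (P i) (deriv (deriv φ)) z := by
    simp only [auxE, Complex.normSq_eq_conj_mul_self]
    ring
  rw [e1, ← sub_eq_zero]
  simp only [Nat.add_sub_cancel, e3]
  push_cast
  linear_combination e2

lemma lapC_auxF {n p : ℕ} (P : Fin n → ℕ) (hP : ∑ i, P i = p) {φ : ℝ → ℝ}
    (hφ : ContDiff ℝ ∞ φ) :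
    lapC (auxF P φ) = fun z =>
      ∑ i, (P i : ℂ) ^ 2 * auxF (Function.update P i (P i - 1)) φ z + auxF P (auxD n p φ) z := by
  funext z
  simp only [lapC, dzbar_dz_auxF _ P hφ]
  rw [Finset.sum_add_distrib, Finset.sum_add_distrib, ← Finset.sum_mul, ← Finset.sum_mul,
    Finset.sum_add_distrib, ← Finset.mul_sum]
  have : (∑ i, (P i : ℂ)) = p := by rw [← hP]; push_cast; rfl
  rw [this]
  simp only [auxF, auxD]
  push_cast
  simp
  ring

lemma main_aux (n l : ℕ) : ∀ (p : ℕ) (φ : ℝ → ℝ), ContDiff ℝ ∞ φ →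
    ∃ C : ℂ, ∀ P : Fin n → ℕ, (∑ i, P i) = p →
      lapC^[l] (auxF P φ) 0 = C * ∏ i, ((P i).factorial : ℂ) := by
  induction l with
  | zero =>
    intro p φ _
    rcases Nat.eq_zero_or_pos p with rfl | hp
    · refine ⟨φ 0, fun P hP => ?_⟩
      have h0 : ∀ i, P i = 0 := by simpa using hP
      simp [auxF, h0]
    · refine ⟨0, fun P hP => ?_⟩
      obtain ⟨i, -, hi⟩ : ∃ i ∈ Finset.univ, P i ≠ 0 := by
        apply Finset.exists_ne_zero_of_sum_ne_zero
        omega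
      have : ∏ i, ((0 : Fin n → ℂ) i * starRingEnd ℂ ((0 : Fin n → ℂ) i)) ^ P i = 0 :=
        Finset.prod_eq_zero (Finset.mem_univ i) (by simp [hi])
      simp only [Function.iterate_zero, id, auxF, this, zero_mul]
  | succ l ih =>
    intro p φ hφ
    obtain ⟨C1, h1⟩ := ih (p - 1) φ hφ
    obtain ⟨C2, h2⟩ := ih p _ (contDiff_auxD n p hφ)
    refine ⟨p * C1 + C2, fun P hP => ?_⟩
    rw [Function.iterate_succ_apply, lapC_auxF P hP hφ,
      lapC_iter_sum l Finset.univ _ _ (fun i => contDiff_auxF _ hφ)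
        (contDiff_auxF P (contDiff_auxD n p hφ))]
    simp only [h2 P hP]
    have key : ∀ i, (P i : ℂ) ^ 2 * lapC^[l] (auxF (Function.update P i (P i - 1)) φ) 0 =
        P i * (C1 * ∏ j, ((P j).factorial : ℂ)) := by
      intro i
      rcases Nat.eq_zero_or_pos (P i) with h | h
      · simp [h]
      have hs : ∑ j, Function.update P i (P i - 1) j = p - 1 := by
        rw [Finset.sum_update_of_mem (Finset.mem_univ i), Finset.sdiff_singleton_eq_erase]
        have := Finset.add_sum_erase Finset.univ P (Finset.mem_univ i)
        omega
      rw [h1 _ hs, ← Finset.mul_prod_erase _ _ (Finset.mem_univ i),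
        ← Finset.mul_prod_erase _ (fun j => ((P j).factorial : ℂ)) (Finset.mem_univ i)]
      have e : ∏ j ∈ Finset.univ.erase i, ((Function.update P i (P i - 1) j).factorial : ℂ) =
          ∏ j ∈ Finset.univ.erase i, ((P j).factorial : ℂ) := by
        refine Finset.prod_congr rfl fun j hj => ?_
        rw [Function.update_of_ne (Finset.ne_of_mem_erase hj)]
      have hf : ((P i).factorial : ℂ) = P i * ((P i - 1).factorial : ℂ) := by
        exact_mod_cast (Nat.mul_factorial_pred h.ne').symm
      rw [e, Function.update_self, hf]
      ring
    simp only [key]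
    rw [← Finset.sum_mul]
    have : (∑ i, (P i : ℂ)) = p := by rw [← hP]; push_cast; rfl
    rw [this]
    ring

/-- there is a constant `C = C(p, l, ψ)`, independent of the particular
multi-index `P` with `|P| = p`, with `(Δ_c)^l(|z^P|² ψ(|z|²))(0) = C ⬝ p! ⬝ P!`. -/
theorem lapC_pow_radial_monomial (n p l : ℕ) (ψ : ℝ → ℝ) (hψ : ContDiff ℝ (⊤ : ℕ∞) ψ) :
    ∃ C : ℂ, ∀ P : Fin n → ℕ, (∑ i, P i) = p →
      (lapC^[l] (fun z : Fin n → ℂ =>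
        (∏ i, (z i * starRingEnd ℂ (z i)) ^ P i) *
          ((ψ (∑ i, Complex.normSq (z i)) : ℝ) : ℂ))) 0 =
      C * (p.factorial : ℂ) * ∏ i, ((P i).factorial : ℂ) := by
  obtain ⟨C, hC⟩ := main_aux n l p ψ hψ
  refine ⟨C / p.factorial, fun P hP => ?_⟩
  have hp : (p.factorial : ℂ) ≠ 0 := by exact_mod_cast p.factorial_ne_zero
  rw [div_mul_cancel₀ _ hp]
  exact hC P hP
end

section
/- Suppose g is a Kähler metric near 0 ∈ ℂⁿ in coordinates w such that for all smooth φ, Δ⁴φ(0) = Σ_{l=0}^{4} a_{4,l}(Δ_c)^l φ(0) with a_{4,4} = 1, and the analogous identities hold for Δ^k, k = 1,2,3 with monic polynomials. Then, comparing fifth-order derivative coefficients, for all indices i, j, h, k, l: (∂_{h\bar k l} g^{i\bar j} + ∂_{i\bar k l} g^{h\bar j} + ∂_{i\bar k h} g^{l\bar j} + ∂_{h\bar j l} g^{i\bar k} + ∂_{i\bar j l} g^{h\bar k} + ∂_{i\bar j h} g^{l\bar k})(0) = 0. -/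
open scoped ComplexOrder

/-- The Kähler Laplacian `Δ = ∑ g^{i \bar j} ∂²/(∂w_j ∂\bar w_i)` associated to a metric
`g` (given as a matrix-valued function, `g w i j = g_{i \bar j}(w)`). -/
noncomputable def kLapG {n : ℕ} (g : (Fin n → ℂ) → Matrix (Fin n) (Fin n) ℂ)
    (f : (Fin n → ℂ) → ℂ) : (Fin n → ℂ) → ℂ :=
  fun z => ∑ i, ∑ j, ((g z)⁻¹ i j) * dzbar i (dz j f) z

/-- Algebraic model of smooth functions near `0` with Wirtinger derivations. -/
structure WData (n : ℕ) (S : Type) [CommRing S] [Algebra ℂ S] where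
  ev : S →ₐ[ℂ] ℂ
  d : Fin n → Derivation ℂ S S
  e : Fin n → Derivation ℂ S S
  z : Fin n → S
  y : Fin n → S
  dd : ∀ i j f, d i (d j f) = d j (d i f)
  ee : ∀ i j f, e i (e j f) = e j (e i f)
  de : ∀ i j f, d i (e j f) = e j (d i f)
  dz : ∀ i j, d i (z j) = if i = j then 1 else 0
  ez : ∀ i j, e i (z j) = 0
  dy : ∀ i j, d i (y j) = 0
  ey : ∀ i j, e i (y j) = if i = j then 1 else 0
  evz : ∀ i, ev (z i) = 0
  evy : ∀ i, ev (y i) = 0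

namespace WData

variable {n : ℕ} {S : Type} [CommRing S] [Algebra ℂ S] (W : WData n S)

/-- vanishing to order `m` at the base point -/
def V : ℕ → S → Prop
  | 0, _ => True
  | m + 1, f => W.ev f = 0 ∧ ∀ i, V m (W.d i f) ∧ V m (W.e i f)

/-- second order operator with coefficients `B` -/
def op (B : Fin n → Fin n → S) (f : S) : S := ∑ i, ∑ j, B i j * W.e i (W.d j f)

/-- flat Laplacian -/
def lc (f : S) : S := ∑ i, W.e i (W.d i f)

variable {W}

lemma V_succ {m : ℕ} {f : S} (h : W.V (m + 1) f) : W.V m f := by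
  induction m generalizing f with
  | zero => trivial
  | succ m ih => exact ⟨h.1, fun i => ⟨ih (h.2 i).1, ih (h.2 i).2⟩⟩

lemma V_mono {a b : ℕ} {f : S} (hab : a ≤ b) (h : W.V b f) : W.V a f := by
  induction b, hab using Nat.le_induction with
  | base => exact h
  | succ b _ ih => exact ih (V_succ h)

lemma V_zero (m : ℕ) : W.V m 0 := by
  induction m with
  | zero => trivial
  | succ m ih => exact ⟨by simp, fun i => ⟨by simpa using ih, by simpa using ih⟩⟩

lemma V_add {m : ℕ} {f g : S} (hf : W.V m f) (hg : W.V m g) : W.V m (f + g) := by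
  induction m generalizing f g with
  | zero => trivial
  | succ m ih =>
    refine ⟨by simp [hf.1, hg.1], fun i => ⟨?_, ?_⟩⟩
    · rw [map_add]; exact ih (hf.2 i).1 (hg.2 i).1
    · rw [map_add]; exact ih (hf.2 i).2 (hg.2 i).2

lemma V_sum {ι : Type} (s : Finset ι) {m : ℕ} {f : ι → S} (h : ∀ i, W.V m (f i)) :
    W.V m (∑ i ∈ s, f i) := by
  classical
  induction s using Finset.induction_on with
  | empty => simpa using V_zero m
  | insert a s ha ih => rw [Finset.sum_insert ha]; exact V_add (h a) ih

lemma V_d {m : ℕ} {f : S} (h : W.V m f) (i : Fin n) : W.V (m - 1) (W.d i f) := by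
  cases m with
  | zero => trivial
  | succ m => exact (h.2 i).1

lemma V_e {m : ℕ} {f : S} (h : W.V m f) (i : Fin n) : W.V (m - 1) (W.e i f) := by
  cases m with
  | zero => trivial
  | succ m => exact (h.2 i).2

lemma V_ev {m : ℕ} {f : S} (h : W.V m f) (hm : 1 ≤ m) : W.ev f = 0 := by
  cases m with
  | zero => omega
  | succ m => exact h.1

lemma V_mul {N a b : ℕ} {f g : S} (hN : N ≤ a + b) (hf : W.V a f) (hg : W.V b g) :
    W.V N (f * g) := by
  induction N generalizing a b f g with
  | zero => trivial
  | succ N ih =>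
    refine ⟨?_, fun i => ⟨?_, ?_⟩⟩
    · rw [map_mul]
      rcases Nat.eq_zero_or_pos a with h | h
      · rw [V_ev hg (by omega), mul_zero]
      · rw [V_ev hf h, zero_mul]
    · rw [Derivation.leibniz, smul_eq_mul, smul_eq_mul]
      exact V_add (ih (by omega) hf (V_d hg i)) (ih (by omega) hg (V_d hf i))
    · rw [Derivation.leibniz, smul_eq_mul, smul_eq_mul]
      exact V_add (ih (by omega) hf (V_e hg i)) (ih (by omega) hg (V_e hf i))

lemma V_z (i : Fin n) : W.V 1 (W.z i) := ⟨W.evz i, fun _ => ⟨trivial, trivial⟩⟩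
lemma V_y (i : Fin n) : W.V 1 (W.y i) := ⟨W.evy i, fun _ => ⟨trivial, trivial⟩⟩

lemma V_op {B : Fin n → Fin n → S} {b m k : ℕ} (hB : ∀ i j, W.V b (B i j)) {f : S}
    (hf : W.V m f) (hk : k ≤ b + (m - 2)) : W.V k (W.op B f) :=
  V_sum _ fun i => V_sum _ fun j => V_mul (by omega) (hB i j) (V_e (V_d hf j) i)

lemma V_lc {m k : ℕ} {f : S} (hf : W.V m f) (hk : k ≤ m - 2) : W.V k (W.lc f) :=
  V_sum _ fun i => V_mono (by omega) (V_e (V_d hf i) i)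

lemma lc_add (f g : S) : W.lc (f + g) = W.lc f + W.lc g := by
  simp [lc, Finset.sum_add_distrib]

lemma op_add (B : Fin n → Fin n → S) (f g : S) : W.op B (f + g) = W.op B f + W.op B g := by
  simp [op, Finset.sum_add_distrib, mul_add]

lemma lc_smul (c : ℂ) (f : S) : W.lc (c • f) = c • W.lc f := by
  simp [lc, Finset.smul_sum]

lemma op_smul (B : Fin n → Fin n → S) (c : ℂ) (f : S) : W.op B (c • f) = c • W.op B f := by
  simp [op, Finset.smul_sum]

lemma lc_zero : W.lc (0 : S) = 0 := by simp [lc]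
lemma op_zero (B : Fin n → Fin n → S) : W.op B (0 : S) = 0 := by simp [op]

/-- Kronecker delta -/
def kd (i j : Fin n) : ℂ := if i = j then 1 else 0

/-- constant coefficients -/
def kS (i j : Fin n) : S := algebraMap ℂ S (kd i j)

lemma kS_eq (i j : Fin n) : (kS i j : S) = if i = j then 1 else 0 := by
  unfold kS kd; split_ifs <;> simp

lemma d_z (i j : Fin n) : W.d i (W.z j) = kS i j := by rw [W.dz, kS_eq]
lemma e_y (i j : Fin n) : W.e i (W.y j) = kS i j := by rw [W.ey, kS_eq]
lemma d_kS (k i j : Fin n) : W.d k (kS i j) = 0 := by simp [kS]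
lemma e_kS (k i j : Fin n) : W.e k (kS i j) = 0 := by simp [kS]

lemma lc_y (a : Fin n) (f : S) : W.lc (W.y a * f) = W.y a * W.lc f + W.d a f := by
  simp [lc, W.dy, e_y, kS_eq, Finset.sum_add_distrib, Finset.mul_sum]

lemma lc_z (a : Fin n) (f : S) : W.lc (W.z a * f) = W.z a * W.lc f + W.e a f := by
  simp only [lc, d_z, W.ez, e_kS, Derivation.leibniz, smul_eq_mul, map_add, mul_zero, zero_add,
    add_zero, Finset.sum_add_distrib, Finset.mul_sum]
  simp [kS_eq]

lemma d_lc (a : Fin n) (f : S) : W.d a (W.lc f) = W.lc (W.d a f) := by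
  simp [lc, W.de, W.dd a]

lemma e_lc (a : Fin n) (f : S) : W.e a (W.lc f) = W.lc (W.e a f) := by
  simp [lc, W.de, W.ee a]

/-- half-contracted operator -/
def opd (W : WData n S) (B : Fin n → Fin n → S) (i : Fin n) (f : S) : S := ∑ j, B i j * W.d j f

lemma opd_y (B : Fin n → Fin n → S) (i a : Fin n) (f : S) :
    W.opd B i (W.y a * f) = W.y a * W.opd B i f := by
  simp [opd, W.dy, Finset.mul_sum, mul_left_comm]

lemma opd_z (B : Fin n → Fin n → S) (i a : Fin n) : W.opd B i (W.z a) = B i a := by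
  simp [opd, d_z, kS_eq]

lemma opd_z_mul (B : Fin n → Fin n → S) (i a : Fin n) (f : S) :
    W.opd B i (W.z a * f) = W.z a * W.opd B i f + f * B i a := by
  simp [opd, d_z, kS_eq, Finset.mul_sum, mul_left_comm, mul_add, Finset.sum_add_distrib, mul_comm]
  rw [add_comm]

lemma op_y_mul (B : Fin n → Fin n → S) (a : Fin n) (f : S) :
    W.op B (W.y a * f) = W.y a * W.op B f + W.opd B a f := by
  simp only [op, opd, W.dy, e_y, Derivation.leibniz, smul_eq_mul, map_add, mul_zero,
    add_zero, Finset.sum_add_distrib, Finset.mul_sum, mul_add]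
  congr 1
  · simp only [mul_left_comm]
  · rw [Finset.sum_comm]
    simp [kS_eq]

lemma op_y (B : Fin n → Fin n → S) (i : Fin n) : W.op B (W.y i) = 0 := by
  simp [op, W.dy]

lemma op_z (B : Fin n → Fin n → S) (i : Fin n) : W.op B (W.z i) = 0 := by
  simp [op, d_z, e_kS]

lemma op_zz (B : Fin n → Fin n → S) (i j : Fin n) : W.op B (W.z i * W.z j) = 0 := by
  simp [op, d_z, e_kS, W.ez]

lemma op_two (B : Fin n → Fin n → S) (i j : Fin n) : W.op B (W.y i * W.z j) = B i j := by
  simp [op_y_mul, op_z, opd_z]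

lemma op_three (B : Fin n → Fin n → S) (i p j : Fin n) :
    W.op B (W.y i * (W.y p * W.z j)) = W.y p * B i j + W.y i * B p j := by
  simp only [op_y_mul, op_z, opd_z, opd_y]
  ring

lemma op_three' (B : Fin n → Fin n → S) (i j q : Fin n) :
    W.op B (W.y i * (W.z j * W.z q)) = W.z q * B i j + W.z j * B i q := by
  simp only [op_y_mul, op_zz, opd_z, opd_z_mul]
  ring

lemma op_five (B : Fin n → Fin n → S) (i p r j q : Fin n) :
    W.op B (W.y i * (W.y p * (W.y r * (W.z j * W.z q)))) =
      W.y p * (W.y r * (W.z q * B i j)) + W.y i * (W.y r * (W.z q * B p j)) +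
      W.y i * (W.y p * (W.z q * B r j)) + W.y p * (W.y r * (W.z j * B i q)) +
      W.y i * (W.y r * (W.z j * B p q)) + W.y i * (W.y p * (W.z j * B r q)) := by
  simp only [op_y_mul, op_zz, opd_z, opd_z_mul, opd_y]
  ring

lemma lc_eq (f : S) : W.lc f = W.op kS f := by
  simp [lc, op, kS_eq]

lemma op_sub (A B : Fin n → Fin n → S) (f : S) :
    W.op A f = W.op B f + W.op (fun i j => A i j - B i j) f := by
  simp [op, ← Finset.sum_add_distrib, ← add_mul]

lemma op_split (A : Fin n → Fin n → S) (f : S) :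
    W.op A f = W.lc f + W.op (fun i j => A i j - kS i j) f := by
  rw [lc_eq, ← op_sub]

lemma mul_kS (f : S) (i j : Fin n) : f * kS i j = kd i j • f := by
  rw [kS, mul_comm, Algebra.smul_def]

lemma kS_mul (f : S) (i j : Fin n) : kS i j * f = kd i j • f := by
  rw [mul_comm, mul_kS]

lemma lc_three (i p j : Fin n) :
    W.lc (W.y i * (W.y p * W.z j)) = kd i j • W.y p + kd p j • W.y i := by
  rw [lc_eq, op_three, mul_kS, mul_kS]

lemma lc_three' (i j q : Fin n) :
    W.lc (W.y i * (W.z j * W.z q)) = kd i j • W.z q + kd i q • W.z j := by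
  rw [lc_eq, op_three', mul_kS, mul_kS]

lemma lc_five (i p r j q : Fin n) :
    W.lc (W.y i * (W.y p * (W.y r * (W.z j * W.z q)))) =
      kd i j • (W.y p * (W.y r * W.z q)) + kd p j • (W.y i * (W.y r * W.z q)) +
      kd r j • (W.y i * (W.y p * W.z q)) + kd i q • (W.y p * (W.y r * W.z j)) +
      kd p q • (W.y i * (W.y r * W.z j)) + kd r q • (W.y i * (W.y p * W.z j)) := by
  rw [lc_eq, op_five]
  simp only [mul_kS, mul_smul_comm]

lemma V_three (i p j : Fin n) : W.V 3 (W.y i * (W.y p * W.z j)) :=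
  V_mul (a := 1) (b := 2) (by omega) (V_y i) (V_mul (a := 1) (b := 1) (by omega) (V_y p) (V_z j))
lemma V_three' (i j q : Fin n) : W.V 3 (W.y i * (W.z j * W.z q)) :=
  V_mul (a := 1) (b := 2) (by omega) (V_y i) (V_mul (a := 1) (b := 1) (by omega) (V_z j) (V_z q))
lemma V_five (i p r j q : Fin n) : W.V 5 (W.y i * (W.y p * (W.y r * (W.z j * W.z q)))) :=
  V_mul (a := 1) (b := 4) (by omega) (V_y i)
    (V_mul (a := 1) (b := 3) (by omega) (V_y p) (V_three' r j q))

theorem main (W : WData n S) (A G : Fin n → Fin n → S)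
    (hAG : ∀ i j, ∑ b, A i b * G b j = kS i j)
    (hd : ∀ i j k, W.d k (G i j) = W.d i (G k j))
    (he : ∀ i j k, W.e k (G i j) = W.e j (G i k))
    (a : ℕ → ℕ → ℝ)
    (hmonic : ∀ k, 1 ≤ k → k ≤ 4 → a k k = 1)
    (hlap : ∀ k, 1 ≤ k → k ≤ 4 → ∀ φ : S,
      W.ev ((W.op A)^[k] φ) = ∑ l ∈ Finset.range (k + 1), (a k l : ℂ) * W.ev (W.lc^[l] φ))
    (i j p q r : Fin n) :
    W.ev (W.d p (W.e q (W.d r (A i j)))) + W.ev (W.d i (W.e q (W.d r (A p j)))) +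
    W.ev (W.d i (W.e q (W.d p (A r j)))) + W.ev (W.d p (W.e j (W.d r (A i q)))) +
    W.ev (W.d i (W.e j (W.d r (A p q)))) + W.ev (W.d i (W.e j (W.d p (A r q)))) = 0 := by
  -- value at the origin
  have hA0 : ∀ i j, W.ev (A i j) = kd i j := by
    intro i j
    have h := hlap 1 le_rfl (by norm_num) (W.y i * W.z j)
    simpa [Finset.sum_range_succ, hmonic 1 le_rfl (by norm_num), op_two, lc_eq, W.evy, kS] using h
  have hG0 : ∀ i j, W.ev (G i j) = kd i j := by
    intro i j
    have h := congrArg W.ev (hAG i j)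
    simpa [hA0, kd, kS] using h
  set B : Fin n → Fin n → S := fun i j => A i j - kS i j with hB
  have hL : ∀ f, W.op A f = W.lc f + W.op B f := op_split A
  have hdB : ∀ k i j, W.d k (A i j) = W.d k (B i j) := by intro k i j; simp [hB, kS]
  have heB : ∀ k i j, W.e k (A i j) = W.e k (B i j) := by intro k i j; simp [hB, kS]
  have hB1 : ∀ i j, W.V 1 (B i j) := fun i j =>
    ⟨by simp [hB, hA0, kS], fun _ => ⟨trivial, trivial⟩⟩
  have hdAG : ∀ k i j, W.ev (W.d k (A i j)) = - W.ev (W.d k (G i j)) := by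
    intro k i j
    have h := congrArg (fun t => W.ev (W.d k t)) (hAG i j)
    simp only [d_kS, e_kS] at h
    simp [hA0, hG0, kd, Finset.sum_add_distrib] at h
    linear_combination h
  have heAG : ∀ k i j, W.ev (W.e k (A i j)) = - W.ev (W.e k (G i j)) := by
    intro k i j
    have h := congrArg (fun t => W.ev (W.e k t)) (hAG i j)
    simp only [d_kS, e_kS] at h
    simp [hA0, hG0, kd, Finset.sum_add_distrib] at h
    linear_combination h
  -- RHS vanish
  have hR : ∀ k, 1 ≤ k → k ≤ 4 → ∀ φ : S, W.V 3 φ → (∀ l, W.ev (W.lc (W.lc^[l+1] φ)) = 0) →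
      W.ev ((W.op A)^[k] φ) = 0 := by
    intro k h1 h4 φ hφ hz
    rw [hlap k h1 h4]
    refine Finset.sum_eq_zero fun l _ => ?_
    have : W.ev (W.lc^[l] φ) = 0 := by
      match l with
      | 0 => exact V_ev hφ (by omega)
      | 1 => exact V_ev (V_lc (k := 1) hφ (by omega)) (by omega)
      | l + 2 => rw [Function.iterate_succ_apply']; exact hz l
    rw [this, mul_zero]
  have hlc0 : ∀ l, W.lc^[l] (0 : S) = 0 := fun l => Function.iterate_fixed lc_zero l
  have hly : ∀ i, W.lc (W.y i) = 0 := fun i => by rw [lc_eq, op_y]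
  have hlz : ∀ i, W.lc (W.z i) = 0 := fun i => by rw [lc_eq, op_z]
  have hc : ∀ φ : S, W.lc (W.lc φ) = 0 → ∀ l, W.ev (W.lc (W.lc^[l+1] φ)) = 0 := by
    intro φ h l
    rw [← Function.iterate_succ_apply' W.lc, Function.iterate_succ_apply,
      Function.iterate_succ_apply, h, hlc0, map_zero]
  have h3 : ∀ i p j, W.lc (W.lc (W.y i * (W.y p * W.z j))) = 0 := by
    intro i p j
    rw [lc_three, lc_add, lc_smul, lc_smul, hly, hly]; simp
  have h3' : ∀ i p j, W.lc (W.lc (W.y i * (W.z p * W.z j))) = 0 := by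
    intro i p j
    rw [lc_three', lc_add, lc_smul, lc_smul, hlz, hlz]; simp
  have o3 : ∀ i p j, W.op A (W.lc (W.y i * (W.y p * W.z j))) = 0 := by
    intro i p j
    rw [lc_three, op_add, op_smul, op_smul, op_y, op_y]; simp
  have o3' : ∀ i p j, W.op A (W.lc (W.y i * (W.z p * W.z j))) = 0 := by
    intro i p j
    rw [lc_three', op_add, op_smul, op_smul, op_z, op_z]; simp
  have hopV1 : ∀ f, W.ev (W.op B f) = 0 := fun f =>
    V_ev (V_op (m := 0) (k := 1) hB1 (f := f) trivial (by omega)) le_rfl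
  -- first derivatives vanish
  have k2 : ∀ i p j, W.ev (W.d p (A i j)) = 0 := by
    intro i p j
    have h := hR 2 (by norm_num) (by norm_num) _ (V_three i p j) (hc _ (h3 i p j))
    simp only [Function.iterate_succ_apply, Function.iterate_zero_apply] at h
    rw [hL (W.y i * (W.y p * W.z j)), op_add, o3, zero_add, hL, map_add, hopV1, add_zero,
      op_three, lc_add, lc_y, lc_y] at h
    simp only [map_add, map_mul, W.evy, zero_mul, zero_add, ← hdB] at h
    have h' : W.ev (W.d p (A i j)) = W.ev (W.d i (A p j)) := by rw [hdAG, hdAG, hd]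
    rw [← h'] at h
    linear_combination h / 2
  have k2' : ∀ i p j, W.ev (W.e p (A i j)) = 0 := by
    intro i p j
    have h := hR 2 (by norm_num) (by norm_num) _ (V_three' i p j) (hc _ (h3' i p j))
    simp only [Function.iterate_succ_apply, Function.iterate_zero_apply] at h
    rw [hL (W.y i * (W.z p * W.z j)), op_add, o3', zero_add, hL, map_add, hopV1, add_zero,
      op_three', lc_add, lc_z, lc_z] at h
    simp only [map_add, map_mul, W.evz, zero_mul, zero_add, ← heB] at h
    have h' : W.ev (W.e p (A i j)) = W.ev (W.e j (A i p)) := by rw [heAG, heAG, he]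
    rw [← h'] at h
    linear_combination h / 2
  have hB2 : ∀ i j, W.V 2 (B i j) := fun i j =>
    ⟨(hB1 i j).1, fun k => ⟨⟨by rw [← hdB, k2], fun _ => ⟨trivial, trivial⟩⟩,
      ⟨by rw [← heB, k2'], fun _ => ⟨trivial, trivial⟩⟩⟩⟩
  have hE : ∀ m f, W.V m f → W.V m (W.op B f) := fun m f hf => V_op hB2 hf (by omega)
  have hLV : ∀ m k f, W.V m f → k ≤ m - 2 → W.V k (W.op A f) := by
    intro m k f hf hk
    rw [hL]
    exact V_add (V_lc hf hk) (V_mono (by omega) (hE m f hf))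
  have two : ∀ f, W.V 3 f → W.ev (W.op A (W.op A f)) = W.ev (W.lc (W.lc f)) := by
    intro f hf
    rw [hL (W.op A f), map_add, hopV1, add_zero, hL, lc_add, map_add,
      V_ev (V_lc (k := 1) (hE 3 f hf) (by omega)) le_rfl, add_zero]
  have three : ∀ f, W.V 5 f →
      W.ev (W.op A (W.op A (W.op A f))) = W.ev (W.lc (W.lc (W.lc f))) := by
    intro f hf
    rw [two _ (hLV 5 3 f hf (by omega)), hL, lc_add, lc_add, map_add,
      V_ev (V_lc (k := 1) (V_lc (k := 3) (hE 5 f hf) (by omega)) (by omega)) le_rfl, add_zero]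
  -- cubic identity
  have cub : ∀ i p j, W.ev (W.lc (W.d p (B i j))) + W.ev (W.lc (W.d i (B p j))) = 0 := by
    intro i p j
    have h := hR 3 (by norm_num) (by norm_num) _ (V_three i p j) (hc _ (h3 i p j))
    simp only [Function.iterate_succ_apply, Function.iterate_zero_apply] at h
    rw [hL (W.y i * (W.y p * W.z j)), op_add, o3, zero_add,
      two _ (hE 3 _ (V_three i p j)), op_three] at h
    simp only [lc_add, lc_y, d_lc, map_add, map_mul, W.evy, zero_mul, zero_add] at h
    linear_combination h / 2
  -- quintic identity
  have h5 : ∀ i p r j q, W.lc (W.lc (W.lc (W.y i * (W.y p * (W.y r * (W.z j * W.z q)))))) = 0 := by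
    intro i p r j q
    rw [lc_five]
    simp only [lc_add, lc_smul, h3, smul_zero, add_zero]
  have hV := V_five (W := W) i p r j q
  have quint : W.ev (W.lc (W.lc (W.lc (W.op B
      (W.y i * (W.y p * (W.y r * (W.z j * W.z q)))))))) = 0 := by
    have key : ∀ l, W.ev (W.lc (W.lc^[l+1] (W.y i * (W.y p * (W.y r * (W.z j * W.z q)))))) = 0 := by
      intro l
      rcases l with _ | l
      · exact V_ev (V_lc (k := 1) (V_lc (k := 3) hV (by omega)) (by omega)) le_rfl
      · rw [Function.iterate_succ_apply]
        exact hc _ (h5 i p r j q) l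
    have h4 := hR 4 (by norm_num) (by norm_num) _ (V_mono (by omega) hV) key
    have h3 := hR 3 (by norm_num) (by norm_num) _ (V_lc (k := 3) hV (by omega))
      (hc _ (h5 i p r j q))
    simp only [Function.iterate_succ_apply, Function.iterate_zero_apply] at h4 h3
    rw [hL (W.y i * (W.y p * (W.y r * (W.z j * W.z q))))] at h4
    simp only [op_add, map_add] at h4
    rw [h3, zero_add, three _ (hE 5 _ hV)] at h4
    exact h4
  have gen : ∀ (p r q : Fin n) (f : S), W.ev (W.lc (W.lc (W.lc (W.y p * (W.y r * (W.z q * f)))))) =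
      6 * (W.ev (W.d p (W.e q (W.d r f))) + kd p q * W.ev (W.lc (W.d r f))
        + kd r q * W.ev (W.lc (W.d p f))) := by
    intro p r q f
    simp only [lc_y, lc_z, lc_add, d_lc, e_lc, map_add, map_mul, W.evy, W.evz, zero_mul, zero_add,
      Derivation.leibniz, smul_eq_mul, W.dy, d_z, mul_zero, add_zero, mul_kS, lc_smul,
      map_smul, Derivation.map_smul]
    have h1 : W.d r (W.d p (W.e q f)) = W.d p (W.e q (W.d r f)) := by
      rw [W.dd, W.de r q]
    have h2 : W.e q (W.d p (W.d r f)) = W.d p (W.e q (W.d r f)) := by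
      rw [W.de p q]
    have h3 : W.e q (W.d r (W.d p f)) = W.d p (W.e q (W.d r f)) := by
      rw [W.dd, W.de p q]
    have h4 : W.d p (W.d r (W.e q f)) = W.d p (W.e q (W.d r f)) := by
      rw [W.de r q]
    have h5 : W.d r (W.e q (W.d p f)) = W.d p (W.e q (W.d r f)) := by
      rw [W.de, W.de, W.dd]
    simp only [h1, h2, h3, h4, h5]
    ring
  rw [op_five] at quint
  simp only [lc_add, map_add, gen] at quint
  simp only [hdB]
  linear_combination quint / 6 - kd p q * cub i r j - kd r q * cub i p j
    - kd i q * cub p r j - kd p j * cub i r q - kd r j * cub i p q - kd i j * cub p r q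
end WData

section analytic

variable {n : ℕ}

/-- smooth functions -/
def Sm (n : ℕ) : Subalgebra ℂ ((Fin n → ℂ) → ℂ) where
  carrier := {f | ContDiff ℝ (⊤ : ℕ∞) f}
  mul_mem' := by
    intro f g hf hg
    exact ContDiff.mul (𝕜 := ℝ) (n := (⊤ : ℕ∞)) (Set.mem_ofPred.mp hf) (Set.mem_ofPred.mp hg)
  add_mem' := by
    intro f g hf hg
    exact ContDiff.add (𝕜 := ℝ) (n := (⊤ : ℕ∞)) (Set.mem_ofPred.mp hf) (Set.mem_ofPred.mp hg)
  algebraMap_mem' := by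
    intro c
    exact (contDiff_const (𝕜 := ℝ) (n := (⊤ : ℕ∞)) (c := c) : ContDiff ℝ (⊤ : ℕ∞) (fun _ : Fin n → ℂ => c))

lemma mem_Sm {f : (Fin n → ℂ) → ℂ} : f ∈ Sm n ↔ ContDiff ℝ (⊤ : ℕ∞) f := Iff.rfl

lemma Sm_smooth (f : Sm n) : ContDiff ℝ (⊤ : ℕ∞) (f : (Fin n → ℂ) → ℂ) := mem_Sm.1 f.2

lemma Sm_diff (f : Sm n) : Differentiable ℝ (f : (Fin n → ℂ) → ℂ) :=
  (Sm_smooth f).differentiable (by simp)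

lemma smooth_dir {f : (Fin n → ℂ) → ℂ} (hf : ContDiff ℝ (⊤ : ℕ∞) f) (v : Fin n → ℂ) :
    ContDiff ℝ (⊤ : ℕ∞) (fun z => fderiv ℝ f z v) :=
  (hf.fderiv_right (m := (⊤ : ℕ∞)) (by simp)).clm_apply contDiff_const

/-- directional derivative as a derivation -/
noncomputable def dv (v : Fin n → ℂ) : Derivation ℂ (Sm n) (Sm n) :=
  Derivation.mk'
    { toFun := fun f => ⟨fun z => fderiv ℝ (f : (Fin n → ℂ) → ℂ) z v, mem_Sm.2 (smooth_dir (Sm_smooth f) v)⟩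
      map_add' := by
        intro f g
        ext z
        simp [fderiv_add (Sm_diff f z) (Sm_diff g z)]
      map_smul' := by
        intro c f
        ext z
        simp [fderiv_const_smul (Sm_diff f z) c] }
    (by
      intro f g
      ext z
      simp [fderiv_mul (Sm_diff f z) (Sm_diff g z)])

lemma dv_coe (v : Fin n → ℂ) (f : Sm n) (z : Fin n → ℂ) :
    (dv v f : (Fin n → ℂ) → ℂ) z = fderiv ℝ (f : (Fin n → ℂ) → ℂ) z v := rfl

lemma dv_comm (v w : Fin n → ℂ) (f : Sm n) : dv v (dv w f) = dv w (dv v f) := by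
  ext z
  have hd : DifferentiableAt ℝ (fderiv ℝ (f : (Fin n → ℂ) → ℂ)) z :=
    ((Sm_smooth f).fderiv_right (m := (⊤ : ℕ∞)) (by simp)).differentiable (by simp) z
  have key : ∀ v w : Fin n → ℂ, (dv v (dv w f) : (Fin n → ℂ) → ℂ) z =
      fderiv ℝ (fderiv ℝ (f : (Fin n → ℂ) → ℂ)) z v w := by
    intro v w
    rw [dv_coe]
    change fderiv ℝ (fun x => fderiv ℝ (f : (Fin n → ℂ) → ℂ) x w) z v = _
    rw [fderiv_clm_apply hd (differentiableAt_const w)]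
    simp
  rw [key, key]
  exact ((Sm_smooth f).contDiffAt.isSymmSndFDerivAt (by simp; exact WithTop.coe_le_coe.2 (le_top : (2 : ℕ∞) ≤ ⊤))) v w

/-- `∂/∂w_i` as a derivation -/
noncomputable def dD (i : Fin n) : Derivation ℂ (Sm n) (Sm n) :=
  (1 / 2 : ℂ) • (dv (Pi.single i 1) - Complex.I • dv (Pi.single i Complex.I))

/-- `∂/∂\bar w_i` as a derivation -/
noncomputable def eD (i : Fin n) : Derivation ℂ (Sm n) (Sm n) :=
  (1 / 2 : ℂ) • (dv (Pi.single i 1) + Complex.I • dv (Pi.single i Complex.I))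

lemma dD_coe (i : Fin n) (f : Sm n) :
    (dD i f : (Fin n → ℂ) → ℂ) = dz i (f : (Fin n → ℂ) → ℂ) := by
  ext z
  simp [dD, dz, dv_coe]
  ring

lemma eD_coe (i : Fin n) (f : Sm n) :
    (eD i f : (Fin n → ℂ) → ℂ) = dzbar i (f : (Fin n → ℂ) → ℂ) := by
  ext z
  simp [eD, dzbar, dv_coe]
  ring

/-- coordinate function -/
def zS (i : Fin n) : Sm n := ⟨fun w => w i, mem_Sm.2 (contDiff_apply ℝ ℂ i)⟩

/-- conjugate coordinate function -/
noncomputable def yS (i : Fin n) : Sm n :=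
  ⟨fun w => (starRingEnd ℂ) (w i), mem_Sm.2 (Complex.conjCLE.contDiff.comp (contDiff_apply ℝ ℂ i))⟩

lemma dv_z (v : Fin n → ℂ) (i : Fin n) (z : Fin n → ℂ) :
    (dv v (zS i) : (Fin n → ℂ) → ℂ) z = v i := by
  rw [dv_coe]
  have : HasFDerivAt (fun w : Fin n → ℂ => w i)
      (ContinuousLinearMap.proj (R := ℝ) (φ := fun _ : Fin n => ℂ) i) z :=
    (ContinuousLinearMap.proj (R := ℝ) (φ := fun _ : Fin n => ℂ) i).hasFDerivAt
  change fderiv ℝ (fun w : Fin n → ℂ => w i) z v = _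
  rw [this.fderiv]; rfl

lemma fderiv_conj' {f : (Fin n → ℂ) → ℂ} {z : Fin n → ℂ} (hf : DifferentiableAt ℝ f z)
    (v : Fin n → ℂ) :
    fderiv ℝ (fun w => (starRingEnd ℂ) (f w)) z v = (starRingEnd ℂ) (fderiv ℝ f z v) := by
  have h := (Complex.conjCLE.hasFDerivAt (x := f z)).comp z hf.hasFDerivAt
  have h' : HasFDerivAt (fun w => (starRingEnd ℂ) (f w)) _ z := h
  rw [h'.fderiv]; simp

lemma dv_y (v : Fin n → ℂ) (i : Fin n) (z : Fin n → ℂ) :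
    (dv v (yS i) : (Fin n → ℂ) → ℂ) z = (starRingEnd ℂ) (v i) := by
  rw [← dv_z v i z, dv_coe, dv_coe]
  exact fderiv_conj' (Sm_diff (zS i) z) v

lemma dzbar_conj {f : (Fin n → ℂ) → ℂ} {z : Fin n → ℂ} (hf : DifferentiableAt ℝ f z)
    (i : Fin n) :
    dzbar i (fun w => (starRingEnd ℂ) (f w)) z = (starRingEnd ℂ) (dz i f z) := by
  have h2 : (starRingEnd ℂ) (2 : ℂ) = 2 := Complex.conj_ofNat 2
  simp [dzbar, dz, fderiv_conj' hf, h2]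

/-- the concrete model -/
noncomputable def WS (n : ℕ) : WData n (Sm n) where
  ev := (Pi.evalAlgHom ℂ (fun _ : Fin n → ℂ => ℂ) 0).comp (Sm n).val
  d := dD
  e := eD
  z := zS
  y := yS
  dd := by
    intro i j f
    simp only [dD, Derivation.smul_apply, Derivation.sub_apply, map_sub,
      Derivation.map_smul]
    simp only [dv_comm (Pi.single i _) (Pi.single j _)]
    module
  ee := by
    intro i j f
    simp only [eD, Derivation.smul_apply, Derivation.add_apply, map_add,
      Derivation.map_smul]
    simp only [dv_comm (Pi.single i _) (Pi.single j _)]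
    module
  de := by
    intro i j f
    simp only [dD, eD, Derivation.smul_apply, Derivation.add_apply, Derivation.sub_apply,
      map_add, map_sub, Derivation.map_smul]
    simp only [dv_comm (Pi.single i _) (Pi.single j _)]
    module
  dz := by
    intro i j
    ext z
    by_cases h : i = j
    · subst h
      simp [dD, dv_z]
      ring
    · simp [dD, dv_z, h, Ne.symm h]
  ez := by
    intro i j
    ext z
    by_cases h : i = j
    · subst h
      simp [eD, dv_z]
    · simp [eD, dv_z, Ne.symm h]
  dy := by
    intro i j
    ext z
    by_cases h : i = j
    · subst h
      simp [dD, dv_y]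
    · simp [dD, dv_y, Ne.symm h]
  ey := by
    intro i j
    ext z
    by_cases h : i = j
    · subst h
      simp [eD, dv_y]
      ring
    · simp [eD, dv_y, h, Ne.symm h]
  evz := by intro i; simp [zS]
  evy := by intro i; simp [yS]

lemma smooth_det {m : ℕ} {M : (Fin n → ℂ) → Matrix (Fin m) (Fin m) ℂ}
    (h : ∀ i j, ContDiff ℝ (⊤ : ℕ∞) (fun w => M w i j)) :
    ContDiff ℝ (⊤ : ℕ∞) (fun w => (M w).det) := by
  simp only [Matrix.det_apply']
  exact ContDiff.sum fun σ _ => contDiff_const.mul (contDiff_prod fun i _ => h _ _)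

lemma smooth_inv {M : (Fin n → ℂ) → Matrix (Fin n) (Fin n) ℂ}
    (h : ∀ i j, ContDiff ℝ (⊤ : ℕ∞) (fun w => M w i j)) (hd : ∀ w, (M w).det ≠ 0) (i j : Fin n) :
    ContDiff ℝ (⊤ : ℕ∞) (fun w => (M w)⁻¹ i j) := by
  simp only [Matrix.inv_def, Ring.inverse_eq_inv', Matrix.smul_apply, smul_eq_mul,
    Matrix.adjugate_apply]
  refine ((smooth_det h).inv hd).mul (smooth_det fun a b => ?_)
  simp only [Matrix.updateRow_apply]
  split_ifs
  · exact contDiff_const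
  · exact h a b

end analytic

/-- if a Kähler metric `g` near `0 ∈ ℂⁿ` satisfies
`Δᵏφ(0) = ∑_{l ≤ k} a_{k,l} (Δ_c)ˡ φ(0)` with `a_{k,k} = 1` for `k = 1, 2, 3, 4` and all
smooth `φ`, then the symmetrized third derivatives of the inverse metric vanish at `0`:
`(∂_{p \bar q r} g^{i \bar j} + ∂_{i \bar q r} g^{p \bar j} + ∂_{i \bar q p} g^{r \bar j}
 + ∂_{p \bar j r} g^{i \bar q} + ∂_{i \bar j r} g^{p \bar q} + ∂_{i \bar j p} g^{r \bar q})(0) = 0`. -/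
theorem symmetrized_third_deriv_inverse_metric (n : ℕ)
    (g : (Fin n → ℂ) → Matrix (Fin n) (Fin n) ℂ)
    (hsm : ∀ i j, ContDiff ℝ (⊤ : ℕ∞) (fun w => g w i j))
    (hpos : ∀ w, (g w).PosDef)
    (hkahler : ∀ w i j k, dz k (fun w' => g w' i j) w = dz i (fun w' => g w' k j) w)
    (a : ℕ → ℕ → ℝ)
    (hmonic : ∀ k, 1 ≤ k → k ≤ 4 → a k k = 1)
    (hlap : ∀ k, 1 ≤ k → k ≤ 4 → ∀ φ : (Fin n → ℂ) → ℂ, ContDiff ℝ (⊤ : ℕ∞) φ →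
      ((kLapG g)^[k] φ) 0 = ∑ l ∈ Finset.range (k + 1), (a k l : ℂ) * (lapC^[l] φ) 0) :
    ∀ i j p q r : Fin n,
      dz p (dzbar q (dz r (fun w => (g w)⁻¹ i j))) 0 +
      dz i (dzbar q (dz r (fun w => (g w)⁻¹ p j))) 0 +
      dz i (dzbar q (dz p (fun w => (g w)⁻¹ r j))) 0 +
      dz p (dzbar j (dz r (fun w => (g w)⁻¹ i q))) 0 +
      dz i (dzbar j (dz r (fun w => (g w)⁻¹ p q))) 0 +
      dz i (dzbar j (dz p (fun w => (g w)⁻¹ r q))) 0 = 0 := by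
  intro i j p q r
  have hdet : ∀ w, (g w).det ≠ 0 := fun w => (hpos w).det_pos.ne'
  let G : Fin n → Fin n → Sm n := fun i j => ⟨fun w => g w i j, mem_Sm.2 (hsm i j)⟩
  let A : Fin n → Fin n → Sm n := fun i j => ⟨fun w => (g w)⁻¹ i j, mem_Sm.2 (smooth_inv hsm hdet i j)⟩
  have hop : ∀ f : Sm n, (((WS n).op A f : Sm n) : (Fin n → ℂ) → ℂ) = kLapG g f := by
    intro f
    ext z
    simp [WData.op, kLapG, WS, eD_coe, dD_coe, A]
  have hlc : ∀ f : Sm n, (((WS n).lc f : Sm n) : (Fin n → ℂ) → ℂ) = lapC f := by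
    intro f
    ext z
    simp [WData.lc, lapC, WS, eD_coe, dD_coe]
  have hop' : ∀ (k : ℕ) (f : Sm n),
      ((((WS n).op A)^[k] f : Sm n) : (Fin n → ℂ) → ℂ) = (kLapG g)^[k] f := by
    intro k f
    induction k with
    | zero => rfl
    | succ k ih => rw [Function.iterate_succ_apply', Function.iterate_succ_apply', hop, ih]
  have hlc' : ∀ (k : ℕ) (f : Sm n),
      ((((WS n).lc)^[k] f : Sm n) : (Fin n → ℂ) → ℂ) = lapC^[k] f := by
    intro k f
    induction k with
    | zero => rfl
    | succ k ih => rw [Function.iterate_succ_apply', Function.iterate_succ_apply', hlc, ih]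
  have hev : ∀ f : Sm n, (WS n).ev f = (f : (Fin n → ℂ) → ℂ) 0 := fun f => rfl
  have hconj : ∀ i j, (fun w => g w i j) = fun w => (starRingEnd ℂ) (g w j i) := by
    intro i j
    ext w
    exact ((hpos w).isHermitian.apply i j).symm
  have main := WData.main (WS n) A G ?_ ?_ ?_ a hmonic ?_ i j p q r
  · simp only [hev] at main
    simpa only [WS, dD_coe, eD_coe, A] using main
  · intro i j
    ext z
    have h := congrFun (congrFun (Matrix.nonsing_inv_mul (g z) (hdet z).isUnit) i) j
    rw [Matrix.mul_apply, Matrix.one_apply] at h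
    rw [WData.kS_eq]
    by_cases hij : i = j
    · simpa [A, G, hij] using h
    · simpa [A, G, hij] using h
  · intro i j k
    ext z
    simpa only [WS, dD_coe, G] using hkahler z i j k
  · intro i j k
    ext z
    simp only [WS, eD_coe, G]
    rw [hconj i j, hconj i k, dzbar_conj ((hsm j i).differentiable (by simp) z),
      dzbar_conj ((hsm k i).differentiable (by simp) z), hkahler]
  · intro k h1 h4 φ
    simp only [hev, hop', hlc']
    exact hlap k h1 h4 φ (Sm_smooth φ)
end
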